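/- Let H be a rank-one affine Hecke algebra with data (Y, α, α∨, q₁, q₀) and element T_s, and let H′ be a rank-one affine Hecke algebra with data (Y′, α′, α′∨, q₁′, q₀′) and element T_{s′}. Let I : H → H′ be a homomorphism of unital ℂ-algebras. Assume: (1) there exist c′ ∈ ℂ∖{0}, a rational number k with 2k ∈ ℤ and k·α′∨ ∈ Y′, and b′ ∈ ℂ[Y′] such that I(T_s) = c′·θ_{k·α′∨}·T_{s′} + b′; (2) there exist c ∈ ℂ∖{0} and a rational number n > 0 with 2n ∈ ℤ and n·α′∨ ∈ Y′ such that I(θ_{α∨}) = c·θ_{n·α′∨}. Then k is an integer, n = 1, c = 1 (so I(θ_{α∨}) = θ_{α′∨}), and: if k is even, then c′ = 1, I(T_s) = θ_{(k/2)·α′∨}·T_{s′}·θ_{−(k/2)·α′∨}, q₁ = q₁′ and q₀ = q₀′; if k is odd, then I(T_s) = θ_{((k−1)/2)·α′∨}·T_{s′,0}·θ_{−((k−1)/2)·α′∨}, where T_{s′,0} := √(q₀′/q₁′)·(θ_{α′∨}·T_{s′} − (q₁′ − 1)·θ_{α′∨}), and q₁ = q₀′, q₀ = q₁′. -/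

import Mathlib

noncomputable section

/-- A rank-one affine Hecke algebra with data `(Y, α, α∨, q₁, q₀)`:
`Y` is a finitely generated free `ℤ`-module, `α : Y → ℤ` is linear, `α∨ ∈ Y` with
`α(α∨) = 2`, `q₁, q₀ > 1` are real numbers with `q₁ = q₀` unless `α(y)` is even for
every `y`.  The algebra `H` is a unital `ℂ`-algebra containing the group algebra
`ℂ[Y]` (embedded via `emb`) as a unital subalgebra, together with an element `Ts`,
such that `H` is free as a left `ℂ[Y]`-module with basis `{1, Ts}`, `Ts` satisfies the
quadratic relation, and the Bernstein relations hold. -/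
structure RankOneAffineHecke (Y : Type*) [AddCommGroup Y]
    (H : Type*) [Ring H] [Algebra ℂ H] where
  /-- `Y` is a free `ℤ`-module. -/
  free : Module.Free ℤ Y
  /-- `Y` is a finitely generated `ℤ`-module. -/
  finite : Module.Finite ℤ Y
  /-- the root `α`, viewed as a linear functional on `Y` -/
  root : Y →+ ℤ
  /-- the coroot `α∨ ∈ Y` -/
  coroot : Y
  root_coroot : root coroot = 2
  /-- the parameter `q₁` -/
  q1 : ℝ
  /-- the parameter `q₀` -/
  q0 : ℝ
  one_lt_q1 : 1 < q1
  one_lt_q0 : 1 < q0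
  q1_eq_q0 : (¬ ∀ y : Y, Even (root y)) → q1 = q0
  /-- the embedding of the group algebra `ℂ[Y]` into `H` -/
  emb : AddMonoidAlgebra ℂ Y →ₐ[ℂ] H
  emb_injective : Function.Injective emb
  /-- the standard generator `T_s` -/
  Ts : H
  /-- `H` is free as a left `ℂ[Y]`-module with basis `{1, Ts}`. -/
  free_module : ∀ h : H, ∃! p : AddMonoidAlgebra ℂ Y × AddMonoidAlgebra ℂ Y,
    h = emb p.1 + emb p.2 * Ts
  /-- the quadratic relation `T_s² = (q₁ − 1)·T_s + q₁·1` -/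
  quadratic : Ts * Ts = ((q1 : ℂ) - 1) • Ts + (q1 : ℂ) • (1 : H)
  /-- `θ_y·T_s − T_s·θ_{s(y)}` lies in `ℂ[Y]` -/
  bernstein_mem : ∀ y : Y,
    emb (AddMonoidAlgebra.single y 1) * Ts
        - Ts * emb (AddMonoidAlgebra.single (y - root y • coroot) 1)
      ∈ Set.range emb
  /-- the Bernstein relation
  `(θ_y·T_s − T_s·θ_{s(y)})·(θ₀ − θ_{−2α∨}) = ((q₁−1)·θ₀ + √q₁(√q₀ − 1/√q₀)·θ_{−α∨})·(θ_y − θ_{s(y)})` -/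
  bernstein : ∀ y : Y,
    (emb (AddMonoidAlgebra.single y 1) * Ts
        - Ts * emb (AddMonoidAlgebra.single (y - root y • coroot) 1))
      * ((1 : H) - emb (AddMonoidAlgebra.single (-(2 • coroot)) 1))
    = (((q1 : ℂ) - 1) • (1 : H)
        + ((Real.sqrt q1 * (Real.sqrt q0 - 1 / Real.sqrt q0) : ℝ) : ℂ)
          • emb (AddMonoidAlgebra.single (-coroot) 1))
      * (emb (AddMonoidAlgebra.single y 1)
          - emb (AddMonoidAlgebra.single (y - root y • coroot) 1))

namespace RankOneAffineHecke

variable {Y : Type*} [AddCommGroup Y] {H : Type*} [Ring H] [Algebra ℂ H]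

/-- the element `θ_y ∈ H` -/
def θ (S : RankOneAffineHecke Y H) (y : Y) : H :=
  S.emb (AddMonoidAlgebra.single y 1)

end RankOneAffineHecke

section Parameters

/-- The polynomial governing reducibility of the principal series with parameters
`q₁ = a ^ 2` and `q₀ = b ^ 2`. -/
def reducibilityPoly (a b : ℝ) (z : ℂ) : ℂ :=
  (1 - a * b * z) * (b + a * z) * ((a * b - z) * (a + b * z))

theorem reducibilityPoly_eq {a b : ℝ} (hb : 1 < b) (z : ℂ) :
    reducibilityPoly a b z = (b : ℂ) ^ 2 *
      (((a : ℂ) ^ 2 * (1 - z ^ 2) - ((a : ℂ) ^ 2 - 1 + a * (b - 1 / b) * z)) *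
        ((1 - z ^ 2) + ((a : ℂ) ^ 2 - 1 + a * (b - 1 / b) * z))) := by
  have hb0 : (b : ℂ) ≠ 0 := by exact_mod_cast (by linarith : b ≠ 0)
  unfold reducibilityPoly
  field_simp
  ring

theorem reducibilityPoly_mul (a b : ℝ) : reducibilityPoly a b (a * b) = 0 := by
  simp [reducibilityPoly]

theorem eq_or_norm_lt_of_reducibilityPoly_eq_zero {a b : ℝ} (ha : 1 < a) (hb : 1 < b) {z : ℂ}
    (h : reducibilityPoly a b z = 0) : z = a * b ∨ ‖z‖ < a * b := by
  have hab : 1 < a * b := by nlinarith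
  have na : ‖(a : ℂ)‖ = a := by simp [abs_of_pos (zero_lt_one.trans ha)]
  have nb : ‖(b : ℂ)‖ = b := by simp [abs_of_pos (zero_lt_one.trans hb)]
  have hz := norm_nonneg z
  rcases mul_eq_zero.1 h with h | h <;> rcases mul_eq_zero.1 h with h | h
  · right
    have := congrArg norm (sub_eq_zero.1 h).symm
    simp only [norm_mul, na, nb, norm_one] at this
    nlinarith
  · right
    have := congrArg norm (eq_neg_of_add_eq_zero_right h)
    rw [norm_mul, norm_neg, na, nb] at this
    nlinarith
  · left
    exact (sub_eq_zero.1 h).symm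
  · right
    have := congrArg norm (eq_neg_of_add_eq_zero_right h)
    rw [norm_mul, norm_neg, na, nb] at this
    nlinarith

theorem one_sub_sq_ne_zero_of_one_lt_norm {z : ℂ} (h : 1 < ‖z‖) : 1 - z ^ 2 ≠ 0 := by
  intro h0
  have h1 := congrArg norm (sub_eq_zero.1 h0).symm
  rw [norm_pow, norm_one] at h1
  nlinarith

theorem mul_eq_or_mul_eq_of_reducibilityPoly_div {a b a' b' : ℝ} (ha : 1 < a) (hb : 1 < b)
    (ha' : 1 < a') (hb' : 1 < b')
    (h : reducibilityPoly a b ((-(b' / a') : ℝ) : ℂ) = 0) : a * b' = b * a' ∨ a * a' = b * b' := by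
  have hx : 0 < b' / a' := by positivity
  have hxa : b' / a' * a' = b' := div_mul_cancel₀ _ (by positivity)
  set x := b' / a'
  have h' : (1 - a * b * (-x)) * (b + a * (-x)) * ((a * b - (-x)) * (a + b * (-x))) = 0 := by
    unfold reducibilityPoly at h
    exact_mod_cast h
  have h1 : 0 < 1 - a * b * (-x) := by
    have : 0 < a * b * x := by positivity
    linarith
  have h2 : 0 < a * b - (-x) := by nlinarith
  rcases mul_eq_zero.1 h' with h | h <;> rcases mul_eq_zero.1 h with h | h
  · exact absurd h h1.ne'
  · left
    linear_combination (-a') * h - a * hxa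
  · exact absurd h h2.ne'
  · right
    linear_combination a' * h + b * hxa

theorem parameters_eq_or_swap {a b a' b' : ℝ} (ha : 1 < a)
    (ha' : 1 < a') (hb' : 1 < b') (hab : a * b = a' * b')
    (h : a * b' = b * a' ∨ a * a' = b * b') : (a = a' ∧ b = b') ∨ (a = b' ∧ b = a') := by
  rcases h with h | h
  · left
    have h1 : a ^ 2 = a' ^ 2 := by
      have : b' * (a ^ 2 - a' ^ 2) = 0 := by linear_combination a * h + a' * hab
      have := (mul_eq_zero.1 this).resolve_left (by positivity)
      linarith
    have h2 : a = a' := (pow_left_inj₀ (by linarith) (by linarith) two_ne_zero).1 h1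
    subst h2
    exact ⟨rfl, mul_left_cancel₀ (by positivity) hab⟩
  · right
    have h1 : a ^ 2 = b' ^ 2 := by
      have : a' * (a ^ 2 - b' ^ 2) = 0 := by linear_combination a * h + b' * hab
      have := (mul_eq_zero.1 this).resolve_left (by positivity)
      linarith
    have h2 : a = b' := (pow_left_inj₀ (by linarith) (by linarith) two_ne_zero).1 h1
    subst h2
    exact ⟨rfl, mul_left_cancel₀ (by positivity) (by linarith)⟩

theorem reducibilityPoly_comparison {a b a' b' : ℝ} (ha : 1 < a) (hb : 1 < b)
    (ha' : 1 < a') (hb' : 1 < b') {C c : ℂ} (hC : C ≠ 0) (hc : c ^ 2 = 1) {N : ℕ} (hN : N ≠ 0)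
    (h : ∀ u : ℂ, u ≠ 0 →
      C * reducibilityPoly a' b' (u ^ 2) * (1 - (c * u ^ N) ^ 2) ^ 2 =
        (1 - (u ^ 2) ^ 2) ^ 2 * reducibilityPoly a b (c * u ^ N)) :
    c = 1 ∧ N = 2 ∧ ((a = a' ∧ b = b') ∨ (a = b' ∧ b = a')) := by
  have hab : 1 < a * b := by nlinarith
  have hab' : 1 < a' * b' := by nlinarith
  have hcn : ‖c‖ = 1 := by
    have := congrArg norm hc
    rw [norm_pow, norm_one] at this
    exact (pow_eq_one_iff_of_nonneg (norm_nonneg c) two_ne_zero).1 this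
  obtain ⟨R, hR, hR2⟩ : ∃ R : ℝ, 1 < R ∧ R ^ 2 = a' * b' :=
    ⟨√(a' * b'), by rw [Real.lt_sqrt zero_le_one]; simpa using hab', Real.sq_sqrt (by linarith)⟩
  have hR2c : (R : ℂ) ^ 2 = a' * b' := by exact_mod_cast hR2
  have hRc : (R : ℂ) ≠ 0 := by exact_mod_cast (by linarith : R ≠ 0)
  have hRn : ‖(R : ℂ)‖ = R := by simp [abs_of_pos (zero_lt_one.trans hR)]
  have from_root (u : ℂ) (hu : u ^ 2 = a' * b') :
      c * u ^ N = a * b ∨ ‖c * u ^ N‖ < a * b := by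
    have hu0 : u ≠ 0 := by
      rintro rfl
      rw [← hR2c, zero_pow two_ne_zero] at hu
      exact pow_ne_zero 2 hRc hu.symm
    have h1 := h u hu0
    rw [hu, reducibilityPoly_mul, mul_zero, zero_mul] at h1
    apply eq_or_norm_lt_of_reducibilityPoly_eq_zero ha hb
    refine (mul_eq_zero.1 h1.symm).resolve_left (pow_ne_zero 2 ?_)
    apply one_sub_sq_ne_zero_of_one_lt_norm
    rw [← hR2c, norm_pow, hRn, hR2]
    exact hab'
  have hle : R ^ N ≤ a * b := by
    have key : ‖c * (R : ℂ) ^ N‖ = R ^ N := by rw [norm_mul, norm_pow, hcn, hRn, one_mul]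
    rw [← key]
    rcases from_root R hR2c with h1 | h1
    · rw [h1]
      simp [abs_of_pos (zero_lt_one.trans ha), abs_of_pos (zero_lt_one.trans hb)]
    · exact h1.le
  have habn : ‖((a : ℂ) * b)‖ = a * b := by
    simp [abs_of_pos (zero_lt_one.trans ha), abs_of_pos (zero_lt_one.trans hb)]
  have to_root (v : ℂ) (hv : c * v ^ N = a * b) : v ^ 2 = a' * b' := by
    have hvn : ‖v‖ ^ N = a * b := by
      have := congrArg norm hv
      rwa [norm_mul, norm_pow, hcn, one_mul, habn] at this
    have hv0 : v ≠ 0 := by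
      rintro rfl
      rw [norm_zero, zero_pow hN] at hvn
      linarith
    have h1 := h v hv0
    rw [hv, reducibilityPoly_mul, mul_zero] at h1
    have h2 := (mul_eq_zero.1 h1).resolve_right
      (pow_ne_zero 2 (one_sub_sq_ne_zero_of_one_lt_norm (by rwa [habn])))
    have h3 := (mul_eq_zero.1 h2).resolve_left hC
    refine (eq_or_norm_lt_of_reducibilityPoly_eq_zero ha' hb' h3).resolve_right fun h4 => ?_
    rw [norm_pow, ← hR2] at h4
    have h5 := lt_of_pow_lt_pow_left₀ 2 (by linarith) h4
    have h6 := pow_lt_pow_left₀ h5 (norm_nonneg v) hN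
    linarith
  have hc0 : c ≠ 0 := by
    rintro rfl
    simp at hc
  have hRN : R ^ N = a * b := by
    obtain ⟨v, hv⟩ := IsAlgClosed.exists_pow_nat_eq ((a : ℂ) * b / c) (Nat.pos_of_ne_zero hN)
    have hv' : c * v ^ N = a * b := by rw [hv]; field_simp
    have h1 := congrArg norm (to_root v hv')
    rw [← hR2c, norm_pow, norm_pow, hRn] at h1
    have h2 := (pow_left_inj₀ (norm_nonneg v) (by linarith) two_ne_zero).1 h1
    have h3 := congrArg norm hv'
    rw [norm_mul, norm_pow, hcn, one_mul, habn, h2] at h3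
    exact h3
  have hRNc : (R : ℂ) ^ N = a * b := by exact_mod_cast hRN
  have hab0 : (a : ℂ) * b ≠ 0 := by
    rw [← norm_pos_iff, habn]
    linarith
  have hc1 : c = 1 := by
    rcases from_root R hR2c with h1 | h1
    · rw [hRNc] at h1
      exact mul_right_cancel₀ hab0 (by rw [h1, one_mul])
    · rw [hRNc, norm_mul, hcn, habn, one_mul] at h1
      exact absurd h1 (lt_irrefl _)
  subst hc1
  have heven : Even N := by
    rcases from_root (-R) (by rw [neg_sq, hR2c]) with h1 | h1
    · by_contra hodd
      rw [(Nat.not_even_iff_odd.1 hodd).neg_pow, hRNc, one_mul] at h1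
      exact hab0 (self_eq_neg.1 h1.symm)
    · rw [one_mul, norm_pow, norm_neg, hRn, hRN] at h1
      exact absurd h1 (lt_irrefl _)
  have hN2 : N = 2 := by
    have hζ := Complex.isPrimitiveRoot_exp N hN
    have h1 := to_root (R * Complex.exp (2 * Real.pi * Complex.I / N))
      (by rw [mul_pow, hζ.pow_eq_one, hRNc]; ring)
    rw [mul_pow, ← hR2c] at h1
    have h2 := hζ.dvd_of_pow_eq_one 2
      (mul_left_cancel₀ (pow_ne_zero 2 hRc) (by rw [h1, mul_one]))
    exact Nat.dvd_antisymm h2 heven.two_dvd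
  subst hN2
  refine ⟨rfl, rfl, ?_⟩
  have habab : a * b = a' * b' := by rw [← hRN, hR2]
  have generic (X : ℂ) (hX : X ≠ 0) (hX1 : 1 - X ^ 2 ≠ 0) :
      C * reducibilityPoly a' b' X = reducibilityPoly a b X := by
    obtain ⟨u, rfl⟩ := IsAlgClosed.exists_pow_nat_eq X zero_lt_two
    have hu : u ≠ 0 := by
      rintro rfl
      exact hX (zero_pow two_ne_zero)
    have := h u hu
    rw [one_mul, mul_comm] at this
    exact mul_left_cancel₀ (pow_ne_zero 2 hX1) this
  have nonsing {s t : ℝ} (hs : 1 < s) (ht : 1 < t) (hst : s ≠ t) :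
      ((-(t / s) : ℝ) : ℂ) ≠ 0 ∧ 1 - ((-(t / s) : ℝ) : ℂ) ^ 2 ≠ 0 := by
    have hpos : 0 < t / s := by positivity
    refine ⟨by exact_mod_cast (by linarith : -(t / s) ≠ 0), ?_⟩
    intro h0
    have h1 : (t / s) ^ 2 = 1 := by
      have : 1 - (-(t / s)) ^ 2 = 0 := by exact_mod_cast h0
      linarith [neg_sq (t / s)]
    have h2 := (pow_eq_one_iff_of_nonneg hpos.le two_ne_zero).1 h1
    rw [div_eq_one_iff_eq (by positivity)] at h2
    exact hst h2.symm
  have root_div {s t : ℝ} (hs : 1 < s) : reducibilityPoly s t ((-(t / s) : ℝ) : ℂ) = 0 := by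
    have : (s : ℂ) ≠ 0 := by exact_mod_cast (by linarith : s ≠ 0)
    have h0 : (t : ℂ) + s * ((-(t / s) : ℝ) : ℂ) = 0 := by
      push_cast
      field_simp
      ring
    simp only [reducibilityPoly, h0, mul_zero, zero_mul]
  apply parameters_eq_or_swap ha ha' hb' habab
  by_cases hs' : a' = b'
  · by_cases hs : a = b
    · left
      rw [hs, hs']
    · obtain ⟨h1, h2⟩ := nonsing ha hb hs
      have h3 := generic _ h1 h2
      rw [root_div ha] at h3
      have h4 := mul_eq_or_mul_eq_of_reducibilityPoly_div ha' hb' ha hb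
        ((mul_eq_zero.1 h3).resolve_left hC)
      rcases h4 with h4 | h4
      · left
        linarith
      · right
        linarith
  · obtain ⟨h1, h2⟩ := nonsing ha' hb' hs'
    have h3 := generic _ h1 h2
    rw [root_div ha', mul_zero] at h3
    exact mul_eq_or_mul_eq_of_reducibilityPoly_div ha hb ha' hb' h3.symm

theorem parameter_sum_ne_zero {a b : ℝ} (ha : 1 < a) (hb : 1 < b) :
    (a : ℂ) ^ 2 - 1 + a * (b - 1 / b) ≠ 0 := by
  have h0 : 0 < a ^ 2 - 1 + a * (b - 1 / b) := by
    have : 1 / b < 1 := by rw [div_lt_one] <;> linarith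
    nlinarith
  exact_mod_cast h0.ne'

theorem scalar_of_parameters_eq {a b : ℝ} (ha : 1 < a) (hb : 1 < b) {c : ℂ}
    (h : (a : ℂ) ^ 2 - 1 + a * (b - 1 / b) = c * ((a : ℂ) ^ 2 - 1 + a * (b - 1 / b))) :
    c = 1 := by
  have h1 := parameter_sum_ne_zero ha hb
  exact mul_right_cancel₀ h1 (by rw [← h, one_mul])

theorem scalar_of_parameters_swap {a b : ℝ} (ha : 1 < a) (hb : 1 < b) {c : ℂ}
    (h : (b : ℂ) ^ 2 - 1 + b * (a - 1 / a) = c * ((a : ℂ) ^ 2 - 1 + a * (b - 1 / b))) :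
    c = b / a := by
  have ha0 : (a : ℂ) ≠ 0 := by exact_mod_cast (by linarith : a ≠ 0)
  have hb0 : (b : ℂ) ≠ 0 := by exact_mod_cast (by linarith : b ≠ 0)
  have h1 := parameter_sum_ne_zero ha hb
  apply mul_right_cancel₀ h1
  rw [← h]
  field_simp
  ring

theorem eq_of_swap_of_proportional {a b : ℝ} (ha : 1 < a) (hb : 1 < b)
    (h : (b : ℂ) ^ 2 - 1 = b / a * ((a : ℂ) ^ 2 - 1)) : a = b := by
  have ha0 : a ≠ 0 := by linarith
  have h' : b ^ 2 - 1 = b / a * (a ^ 2 - 1) := by exact_mod_cast h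
  field_simp at h'
  have : (b - a) * (a * b + 1) = 0 := by linear_combination h'
  have := (mul_eq_zero.1 this).resolve_right (by nlinarith)
  linarith

theorem eq_of_self_proportional {a b : ℝ} (ha : 1 < a) (hb : 1 < b)
    (h : (a : ℂ) ^ 2 - 1 = a * (b - 1 / b)) : a = b := by
  have hb0 : b ≠ 0 := by linarith
  have h' : a ^ 2 - 1 = a * (b - 1 / b) := by exact_mod_cast h
  field_simp at h'
  have : (a - b) * (a * b + 1) = 0 := by linear_combination h'
  have := (mul_eq_zero.1 this).resolve_right (by nlinarith)
  linarith

end Parameters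

namespace RankOneAffineHecke

section Structure

variable {Y : Type*} [AddCommGroup Y] {H : Type*} [Ring H] [Algebra ℂ H]
  (S : RankOneAffineHecke Y H)

open AddMonoidAlgebra (single)

theorem isAddTorsionFree (S : RankOneAffineHecke Y H) : IsAddTorsionFree Y := by
  have := S.free
  exact IsAddTorsionFree.of_isTorsionFree ℤ Y

theorem isDomain (S : RankOneAffineHecke Y H) : IsDomain (AddMonoidAlgebra ℂ Y) := by
  have := S.isAddTorsionFree
  have : AddMonoid.FG Y := AddGroup.fg_iff_addMonoid_fg.1 (Module.Finite.iff_addGroup_fg.1 S.finite)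
  infer_instance

/-- The simple reflection acting on the group algebra `ℂ[Y]`. -/
def reflection : AddMonoidAlgebra ℂ Y →ₐ[ℂ] AddMonoidAlgebra ℂ Y :=
  AddMonoidAlgebra.mapDomainAlgHom ℂ ℂ
    (AddMonoidHom.mk' (fun y => y - S.root y • S.coroot) fun y z => by
      simp only [map_add, add_smul]
      abel)

theorem reflection_single (y : Y) (t : ℂ) :
    S.reflection (single y t) = single (y - S.root y • S.coroot) t :=
  AddMonoidAlgebra.mapDomain_single

/-- The scalar `q₁ - 1`. -/
def p : ℂ := (S.q1 : ℂ) - 1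

/-- The scalar `√q₁ (√q₀ - 1 / √q₀)`. -/
def r : ℂ := ((Real.sqrt S.q1 * (Real.sqrt S.q0 - 1 / Real.sqrt S.q0) : ℝ) : ℂ)

/-- The numerator of the Bernstein relation. -/
def num : AddMonoidAlgebra ℂ Y := algebraMap ℂ _ S.p + algebraMap ℂ _ S.r * single (-S.coroot) 1

/-- The denominator of the Bernstein relation. -/
def den : AddMonoidAlgebra ℂ Y := 1 - single (-S.coroot) 1 ^ 2

theorem single_pow_two (y : Y) : (single y 1 : AddMonoidAlgebra ℂ Y) ^ 2 = single (2 • y) 1 := by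
  rw [sq, AddMonoidAlgebra.single_mul_single, two_smul, mul_one]

theorem single_neg_mul_single (y : Y) :
    (single (-y) 1 : AddMonoidAlgebra ℂ Y) * single y 1 = 1 := by
  rw [AddMonoidAlgebra.single_mul_single, neg_add_cancel, mul_one]
  rfl

theorem coroot_ne_zero : S.coroot ≠ 0 := by
  intro h
  have := S.root_coroot
  rw [h, map_zero] at this
  omega

theorem den_ne_zero : S.den ≠ 0 := by
  have := S.isAddTorsionFree
  intro h
  rw [den, single_pow_two, sub_eq_zero, AddMonoidAlgebra.one_def] at h
  have h1 := AddMonoidAlgebra.of_injective (R := ℂ) (M := Y) (a₁ := Multiplicative.ofAdd 0)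
    (a₂ := Multiplicative.ofAdd (2 • -S.coroot))
    (by rw [AddMonoidAlgebra.of_apply, AddMonoidAlgebra.of_apply]; exact h)
  have h2 : (2 : ℕ) • -S.coroot = 0 := (Multiplicative.ofAdd.injective h1).symm
  rw [smul_neg, neg_eq_zero] at h2
  exact S.coroot_ne_zero ((smul_eq_zero_iff_right two_ne_zero).1 h2)

theorem eq_of_emb_add_emb_mul_Ts_eq {a b a' b' : AddMonoidAlgebra ℂ Y}
    (h : S.emb a + S.emb b * S.Ts = S.emb a' + S.emb b' * S.Ts) : a = a' ∧ b = b' := by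
  have := (S.free_module _).unique (y₁ := (a, b)) (y₂ := (a', b')) rfl h
  exact Prod.mk.inj this

theorem exists_Ts_mul_emb (b : AddMonoidAlgebra ℂ Y) : ∃ g : AddMonoidAlgebra ℂ Y,
    S.Ts * S.emb b = S.emb (S.reflection b) * S.Ts + S.emb g ∧
      g * S.den = S.num * (b - S.reflection b) := by
  induction b using AddMonoidAlgebra.induction_linear with
  | zero => exact ⟨0, by simp⟩
  | add x y hx hy =>
    obtain ⟨g, hg, hg'⟩ := hx
    obtain ⟨k, hk, hk'⟩ := hy
    refine ⟨g + k, ?_, ?_⟩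
    · rw [map_add, mul_add, hg, hk, map_add, map_add, map_add, add_mul]
      abel
    · rw [add_mul, hg', hk', map_add]
      ring
  | single y t =>
    have hs : ∀ z : Y, (single z t : AddMonoidAlgebra ℂ Y) = algebraMap ℂ _ t * single z 1 := by
      intro z
      rw [← Algebra.smul_def, AddMonoidAlgebra.smul_single, smul_eq_mul, mul_one]
    have hss : y - S.root y • S.coroot -
        S.root (y - S.root y • S.coroot) • S.coroot = y := by
      have : S.root (y - S.root y • S.coroot) = - S.root y := by
        rw [map_sub, map_zsmul, S.root_coroot, smul_eq_mul]
        ring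
      rw [this, neg_smul]
      abel
    obtain ⟨f, hf⟩ := S.bernstein_mem (y - S.root y • S.coroot)
    have hb := S.bernstein (y - S.root y • S.coroot)
    rw [← hf, hss] at hb
    rw [hss] at hf
    refine ⟨algebraMap ℂ _ t * -f, ?_, ?_⟩
    · rw [reflection_single, hs, hs (y - _), map_mul, map_mul, map_mul, map_neg, hf,
        AlgHom.commutes, ← mul_assoc, ← Algebra.commutes t S.Ts]
      noncomm_ring
    · have hb' : f * S.den = S.num *
          (single (y - S.root y • S.coroot) 1 - single y 1) := by
        apply S.emb_injective
        rw [map_mul, map_mul, num, den, single_pow_two, smul_neg, map_sub, map_sub, map_add,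
          map_mul, map_one, AlgHom.commutes, AlgHom.commutes, ← Algebra.smul_def,
          Algebra.algebraMap_eq_smul_one]
        exact hb
      rw [reflection_single, hs y, hs (y - _)]
      linear_combination (-algebraMap ℂ (AddMonoidAlgebra ℂ Y) t) * hb'

theorem Ts_mul_Ts : S.Ts * S.Ts = algebraMap ℂ H S.p * S.Ts + algebraMap ℂ H S.q1 := by
  rw [S.quadratic, Algebra.smul_def, Algebra.smul_def, mul_one]
  rfl

theorem Ts_mul_neg_coroot : S.Ts * S.θ (-S.coroot) =
    S.θ S.coroot * S.Ts - (algebraMap ℂ H S.p * S.θ S.coroot + algebraMap ℂ H S.r) := by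
  have := S.isDomain
  obtain ⟨g, hg, hg'⟩ := S.exists_Ts_mul_emb (single (-S.coroot) 1)
  have hr : -S.coroot - S.root (-S.coroot) • S.coroot = S.coroot := by
    rw [map_neg, S.root_coroot]
    module
  rw [reflection_single, hr] at hg hg'
  have hx := single_neg_mul_single S.coroot
  have hge : g = -(algebraMap ℂ _ S.p * single S.coroot 1 + algebraMap ℂ _ S.r) := by
    apply mul_right_cancel₀ S.den_ne_zero
    rw [hg', num, den]
    linear_combination (-algebraMap ℂ (AddMonoidAlgebra ℂ Y) S.p * single (-S.coroot) 1
      - algebraMap ℂ (AddMonoidAlgebra ℂ Y) S.r) * hx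
  rw [θ, θ, hg, hge, map_neg, map_add, map_mul, AlgHom.commutes, AlgHom.commutes, sub_eq_add_neg]

theorem quadratic_coefficients {P b : AddMonoidAlgebra ℂ Y} {p q : ℂ}
    (h : (S.emb P * S.Ts + S.emb b) * (S.emb P * S.Ts + S.emb b) =
      algebraMap ℂ H p * (S.emb P * S.Ts + S.emb b) + algebraMap ℂ H q) :
    (algebraMap ℂ _ (S.q1 : ℂ) * (P * S.reflection P) + b ^ 2 - algebraMap ℂ _ p * b
        - algebraMap ℂ _ q) * S.den + P * S.num * (b - S.reflection b) = 0 ∧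
    (algebraMap ℂ _ S.p * (P * S.reflection P) + P * S.reflection b + b * P
        - algebraMap ℂ _ p * P) * S.den + P * S.num * (P - S.reflection P) = 0 := by
  obtain ⟨g, hg, hg'⟩ := S.exists_Ts_mul_emb P
  obtain ⟨k, hk, hk'⟩ := S.exists_Ts_mul_emb b
  have expand : (S.emb P * S.Ts + S.emb b) * (S.emb P * S.Ts + S.emb b) =
      S.emb (P * S.reflection P * algebraMap ℂ _ (S.q1 : ℂ) + P * k + b * b) +
      S.emb (P * S.reflection P * algebraMap ℂ _ S.p + P * g + P * S.reflection b + b * P)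
        * S.Ts := by
    calc _ = S.emb P * (S.Ts * S.emb P) * S.Ts + S.emb P * (S.Ts * S.emb b)
          + S.emb b * S.emb P * S.Ts + S.emb b * S.emb b := by noncomm_ring
      _ = S.emb P * S.emb (S.reflection P) * (S.Ts * S.Ts) + S.emb P * S.emb g * S.Ts
          + S.emb P * (S.emb (S.reflection b) * S.Ts + S.emb k)
          + S.emb b * S.emb P * S.Ts + S.emb b * S.emb b := by
        rw [hg, hk]
        noncomm_ring
      _ = _ := by
        rw [S.Ts_mul_Ts]
        simp only [map_add, map_mul, AlgHom.commutes]
        noncomm_ring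
  have rhs : algebraMap ℂ H p * (S.emb P * S.Ts + S.emb b) + algebraMap ℂ H q =
      S.emb (algebraMap ℂ _ p * b + algebraMap ℂ _ q) + S.emb (algebraMap ℂ _ p * P) * S.Ts := by
    simp only [map_add, map_mul, AlgHom.commutes]
    noncomm_ring
  rw [expand, rhs] at h
  obtain ⟨h1, h2⟩ := S.eq_of_emb_add_emb_mul_Ts_eq h
  constructor
  · linear_combination S.den * h1 - P * hk'
  · linear_combination S.den * h2 - P * hg'

/-- Evaluation of the group algebra at the character `y ↦ u ^ (-α(y))`. -/
def eval (u : ℂˣ) : AddMonoidAlgebra ℂ Y →ₐ[ℂ] ℂ :=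
  AddMonoidAlgebra.lift ℂ ℂ Y
    ((Units.coeHom ℂ).comp ((zpowersHom ℂˣ u⁻¹).comp (AddMonoidHom.toMultiplicative S.root)))

theorem eval_single (u : ℂˣ) (y : Y) (t : ℂ) :
    S.eval u (single y t) = t * (u : ℂ) ^ (-S.root y) := by
  rw [eval, AddMonoidAlgebra.lift_single, smul_eq_mul]
  simp

theorem root_eq_of_two_smul_eq {y : Y} {K : ℤ} (h : (2 : ℤ) • y = K • S.coroot) :
    S.root y = K := by
  have := congrArg S.root h
  rw [map_zsmul, map_zsmul, S.root_coroot, smul_eq_mul, smul_eq_mul] at this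
  omega

theorem reflection_single_of_two_smul_eq {y : Y} {K : ℤ} (h : (2 : ℤ) • y = K • S.coroot) (t : ℂ) :
    S.reflection (single y t) = single (-y) t := by
  rw [reflection_single, S.root_eq_of_two_smul_eq h, ← h]
  congr 1
  module

theorem exists_Ts_mul_smul_coroot (m : ℤ) : ∃ g : AddMonoidAlgebra ℂ Y,
    S.Ts * S.θ (-(m • S.coroot)) = S.θ (m • S.coroot) * S.Ts + S.emb g ∧
      g * S.den = S.num * (single (-(m • S.coroot)) 1 - single (m • S.coroot) 1) := by
  obtain ⟨g, hg, hg'⟩ := S.exists_Ts_mul_emb (single (-(m • S.coroot)) 1)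
  have h2 : (2 : ℤ) • (-(m • S.coroot)) = (-(2 * m)) • S.coroot := by module
  rw [S.reflection_single_of_two_smul_eq h2, neg_neg] at hg hg'
  exact ⟨g, hg, hg'⟩

theorem conj_Ts (m : ℤ) {b : AddMonoidAlgebra ℂ Y}
    (hb : b * S.den = S.num - single ((2 * m) • S.coroot) 1 * S.num) :
    S.emb (single ((2 * m) • S.coroot) 1) * S.Ts + S.emb b =
      S.θ (m • S.coroot) * S.Ts * S.θ (-(m • S.coroot)) := by
  have := S.isDomain
  obtain ⟨g, hg, hg'⟩ := S.exists_Ts_mul_smul_coroot m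
  have hx := single_neg_mul_single (m • S.coroot)
  have hm : (single ((2 * m) • S.coroot) 1 : AddMonoidAlgebra ℂ Y) =
      single (m • S.coroot) 1 * single (m • S.coroot) 1 := by
    rw [AddMonoidAlgebra.single_mul_single, mul_one]
    congr 1
    module
  have hbg : b = single (m • S.coroot) 1 * g := by
    apply mul_right_cancel₀ S.den_ne_zero
    rw [hb, hm]
    linear_combination (-single (m • S.coroot) 1 : AddMonoidAlgebra ℂ Y) * hg' - S.num * hx
  rw [mul_assoc, hg, hbg, hm, map_mul, map_mul, θ]
  noncomm_ring

theorem conj_Ts_zero (m : ℤ) (κ : ℂ) {b : AddMonoidAlgebra ℂ Y}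
    (hb : b * S.den = algebraMap ℂ _ κ * (algebraMap ℂ _ S.r
      + algebraMap ℂ _ S.p * single (-S.coroot) 1 - single ((2 * m + 1) • S.coroot) 1 * S.num)) :
    S.emb (algebraMap ℂ _ κ * single ((2 * m + 1) • S.coroot) 1) * S.Ts + S.emb b =
      S.θ (m • S.coroot) * (κ • (S.θ S.coroot * S.Ts - ((S.q1 : ℂ) - 1) • S.θ S.coroot))
        * S.θ (-(m • S.coroot)) := by
  have := S.isDomain
  obtain ⟨g, hg, hg'⟩ := S.exists_Ts_mul_smul_coroot m
  have hx := single_neg_mul_single (m • S.coroot)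
  have hα := single_neg_mul_single S.coroot
  have hm : (single ((2 * m + 1) • S.coroot) 1 : AddMonoidAlgebra ℂ Y) =
      single (m • S.coroot) 1 * single S.coroot 1 * single (m • S.coroot) 1 := by
    rw [AddMonoidAlgebra.single_mul_single, AddMonoidAlgebra.single_mul_single, mul_one, mul_one]
    congr 1
    module
  have hbg : b = algebraMap ℂ _ κ * (single (m • S.coroot) 1 * single S.coroot 1 * g
      - algebraMap ℂ _ S.p * (single (m • S.coroot) 1 * single S.coroot 1
        * single (-(m • S.coroot)) 1)) := by
    apply mul_right_cancel₀ S.den_ne_zero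
    have hnum : single S.coroot 1 * S.num - algebraMap ℂ _ S.p * single S.coroot 1 * S.den =
        algebraMap ℂ _ S.r + algebraMap ℂ _ S.p * single (-S.coroot) 1 := by
      rw [num, den]
      linear_combination (algebraMap ℂ (AddMonoidAlgebra ℂ Y) S.r +
        algebraMap ℂ (AddMonoidAlgebra ℂ Y) S.p * single (-S.coroot) 1) * hα
    rw [hb, hm, ← hnum]
    linear_combination
      (-algebraMap ℂ (AddMonoidAlgebra ℂ Y) κ * single (m • S.coroot) 1 * single S.coroot 1) * hg'
      - algebraMap ℂ (AddMonoidAlgebra ℂ Y) κ * single S.coroot 1 *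
        (S.num - algebraMap ℂ (AddMonoidAlgebra ℂ Y) S.p * S.den) * hx
  have hT : S.θ (m • S.coroot) * (κ • (S.θ S.coroot * S.Ts - ((S.q1 : ℂ) - 1) • S.θ S.coroot))
        * S.θ (-(m • S.coroot)) = algebraMap ℂ H κ * (S.θ (m • S.coroot) * S.θ S.coroot *
          (S.Ts * S.θ (-(m • S.coroot))) - algebraMap ℂ H S.p *
          (S.θ (m • S.coroot) * S.θ S.coroot * S.θ (-(m • S.coroot)))) := by
    simp only [← Algebra.smul_def, mul_sub, sub_mul, smul_sub, mul_smul_comm, smul_mul_assoc, p,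
      mul_assoc]
    rw [smul_comm κ ((S.q1 : ℂ) - 1)]
  rw [hT, hg, hbg, hm]
  simp only [map_mul, map_sub, AlgHom.commutes, θ]
  noncomm_ring

end Structure

section Hom

variable {Y : Type*} [AddCommGroup Y] {H : Type*} [Ring H] [Algebra ℂ H]
  {Y' : Type*} [AddCommGroup Y'] {H' : Type*} [Ring H'] [Algebra ℂ H']
  (S : RankOneAffineHecke Y H) (S' : RankOneAffineHecke Y' H') (I : H →ₐ[ℂ] H')

open AddMonoidAlgebra (single)

theorem map_θ_neg {c : ℂ} (hc : c ≠ 0) {y : Y} {y' : Y'} (h : I (S.θ y) = c • S'.θ y') :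
    I (S.θ (-y)) = c⁻¹ • S'.θ (-y') := by
  have h1 : S.θ (-y) * S.θ y = 1 := by
    rw [θ, θ, ← map_mul, single_neg_mul_single, map_one]
  have h2 : S'.θ y' * S'.θ (-y') = 1 := by
    rw [θ, θ, ← map_mul, mul_comm, single_neg_mul_single, map_one]
  have h3 := congrArg I h1
  rw [map_mul, map_one, h] at h3
  calc I (S.θ (-y)) = I (S.θ (-y)) * ((c * c⁻¹) • (S'.θ y' * S'.θ (-y'))) := by
        rw [mul_inv_cancel₀ hc, h2, one_smul, mul_one]
    _ = (I (S.θ (-y)) * (c • S'.θ y')) * (c⁻¹ • S'.θ (-y')) := by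
        simp only [mul_smul_comm, smul_mul_assoc, mul_smul, mul_assoc]
        rw [smul_comm]
    _ = _ := by rw [h3, one_mul]

variable {P b : AddMonoidAlgebra ℂ Y'}

theorem bernstein_of_hom (hT : I S.Ts = S'.emb P * S'.Ts + S'.emb b) (hP : P ≠ 0)
    {c : ℂ} (hc : c ≠ 0) {N : ℤ} {y : Y'} (hy : (2 : ℤ) • y = N • S'.coroot)
    (hI : I (S.θ S.coroot) = c • S'.θ y) :
    c ^ 2 = 1 ∧ (1 - single (-y) 1 ^ 2) * (b * S'.den + P * S'.num) =
      (algebraMap ℂ _ S.p + algebraMap ℂ _ (c * S.r) * single (-y) 1) * S'.den := by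
  have := S'.isDomain
  have hneg := map_θ_neg S S' I hc hI
  have hrel := congrArg I S.Ts_mul_neg_coroot
  simp only [θ] at hI hneg
  simp only [map_mul, map_sub, map_add, AlgHom.commutes, hT, hI, hneg, Algebra.smul_def, θ] at hrel
  obtain ⟨g, hg, hg'⟩ := S'.exists_Ts_mul_emb (single (-y) 1)
  rw [S'.reflection_single_of_two_smul_eq (K := -N) (by rw [smul_neg, hy, neg_smul]), neg_neg]
    at hg hg'
  have hl : (S'.emb P * S'.Ts + S'.emb b) * (algebraMap ℂ H' c⁻¹ * S'.emb (single (-y) 1)) =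
      S'.emb (algebraMap ℂ _ c⁻¹ * (P * g + b * single (-y) 1)) +
        S'.emb (algebraMap ℂ _ c⁻¹ * (P * single y 1)) * S'.Ts := by
    calc
      _ = algebraMap ℂ H' c⁻¹ * (S'.emb P * (S'.Ts * S'.emb (single (-y) 1)) +
          S'.emb b * S'.emb (single (-y) 1)) := by
        rw [← mul_assoc, ← Algebra.commutes]
        noncomm_ring
      _ = _ := by
        rw [hg]
        simp only [map_add, map_mul, AlgHom.commutes]
        noncomm_ring
  have hr : algebraMap ℂ H' c * S'.emb (single y 1) * (S'.emb P * S'.Ts + S'.emb b) -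
      (algebraMap ℂ H' S.p * (algebraMap ℂ H' c * S'.emb (single y 1)) + algebraMap ℂ H' S.r) =
      S'.emb (algebraMap ℂ _ c * single y 1 * b -
        (algebraMap ℂ _ S.p * (algebraMap ℂ _ c * single y 1) + algebraMap ℂ _ S.r)) +
        S'.emb (algebraMap ℂ _ c * single y 1 * P) * S'.Ts := by
    simp only [map_add, map_sub, map_mul, AlgHom.commutes]
    noncomm_ring
  rw [hl, hr] at hrel
  obtain ⟨h1, h2⟩ := S'.eq_of_emb_add_emb_mul_Ts_eq hrel
  have hx := single_neg_mul_single y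
  have hcc : c⁻¹ = c := by
    have hZ : (single y 1 : AddMonoidAlgebra ℂ Y') ≠ 0 := right_ne_zero_of_mul_eq_one hx
    apply (algebraMap ℂ (AddMonoidAlgebra ℂ Y')).injective
    apply mul_right_cancel₀ (mul_ne_zero hP hZ)
    rw [h2]
    ring
  have hc2 : c ^ 2 = 1 := by
    rw [sq]
    nth_rewrite 1 [← hcc]
    exact inv_mul_cancel₀ hc
  refine ⟨hc2, ?_⟩
  rw [hcc] at h1
  have hc2' : algebraMap ℂ (AddMonoidAlgebra ℂ Y') c * algebraMap ℂ _ c = 1 := by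
    rw [← map_mul, ← sq, hc2, map_one]
  rw [map_mul]
  have h3 : P * g + b * single (-y) 1 = single y 1 * b - (algebraMap ℂ _ S.p * single y 1 +
      algebraMap ℂ _ c * algebraMap ℂ _ S.r) := by
    linear_combination algebraMap ℂ (AddMonoidAlgebra ℂ Y') c * h1 -
      (P * g + b * single (-y) 1 - single y 1 * b + algebraMap ℂ _ S.p * single y 1) * hc2'
  linear_combination (-single (-y) 1 * S'.den : AddMonoidAlgebra ℂ Y') * h3 +
    single (-y) 1 * P * hg' + (algebraMap ℂ (AddMonoidAlgebra ℂ Y') S.p * S'.den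
      - P * S'.num - b * S'.den) * hx

theorem quadratic_elimination {A : Type*} [CommRing A] {P P' b b' p p' q q' w d z t : A}
    (hp : p = q - 1) (hp' : p' = q' - 1)
    (h1 : (q' * (P * P') + b ^ 2 - p * b - q) * d + P * w * (b - b') = 0)
    (h2 : (p' * (P * P') + P * b' + b * P - p * P) * d + P * w * (P - P') = 0)
    (h3 : (1 - z ^ 2) * (b * d + P * w) = (p + t) * d) :
    P * P' * ((q' * d - w) * (d + w)) * (1 - z ^ 2) ^ 2 =
      d ^ 2 * ((q * (1 - z ^ 2) - (p + t)) * ((1 - z ^ 2) + (p + t))) := by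
  have key : P * P' * ((q' * d - w) * (d + w)) =
      q * d ^ 2 + (b * d + P * w) * (p * d - (b * d + P * w)) := by
    subst hp'
    linear_combination d * h1 + w * h2
  subst hp
  rw [key]
  linear_combination ((q - 1) * d * (1 - z ^ 2) - (1 - z ^ 2) * (b * d + P * w)
    - (q - 1 + t) * d) * h3

/-- The scalar form of the parameters, in terms of `√q₁` and `√q₀`. -/
theorem parameters (S : RankOneAffineHecke Y H) : ∃ a b : ℝ, 1 < a ∧ 1 < b ∧
    S.q1 = a ^ 2 ∧ S.q0 = b ^ 2 ∧ √S.q1 = a ∧ √S.q0 = b ∧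
    S.p = (a : ℂ) ^ 2 - 1 ∧ S.r = (a : ℂ) * (b - 1 / b) := by
  have h1 : S.q1 = √S.q1 ^ 2 := (Real.sq_sqrt (by linarith [S.one_lt_q1])).symm
  have h0 : S.q0 = √S.q0 ^ 2 := (Real.sq_sqrt (by linarith [S.one_lt_q0])).symm
  refine ⟨√S.q1, √S.q0, ?_, ?_, h1, h0, rfl, rfl, ?_, ?_⟩
  · rw [Real.lt_sqrt zero_le_one, one_pow]
    exact S.one_lt_q1
  · rw [Real.lt_sqrt zero_le_one, one_pow]
    exact S.one_lt_q0
  · rw [p]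
    nth_rewrite 1 [h1]
    push_cast
    rfl
  · rw [r]
    push_cast
    rfl

theorem p_add_r_ne_zero (S : RankOneAffineHecke Y H) : S.p + S.r ≠ 0 := by
  obtain ⟨a, b, ha, hb, -, -, -, -, hp, hr⟩ := S.parameters
  rw [hp, hr]
  exact parameter_sum_ne_zero ha hb

theorem polynomial_identity_of_hom (hT : I S.Ts = S'.emb P * S'.Ts + S'.emb b) (hP : P ≠ 0)
    {c c' : ℂ} (hc : c ≠ 0) {K : ℤ} {yk : Y'} (hyk : (2 : ℤ) • yk = K • S'.coroot)
    (hPk : P = single yk c') {N : ℤ} {y : Y'} (hy : (2 : ℤ) • y = N • S'.coroot)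
    (hI : I (S.θ S.coroot) = c • S'.θ y) (u : ℂ) (hu : u ≠ 0) :
    c' ^ 2 * (((S'.q1 : ℂ) * (1 - (u ^ 2) ^ 2) - (S'.p + S'.r * u ^ 2)) *
        ((1 - (u ^ 2) ^ 2) + (S'.p + S'.r * u ^ 2))) * (1 - (u ^ N) ^ 2) ^ 2 =
      (1 - (u ^ 2) ^ 2) ^ 2 * (((S.q1 : ℂ) * (1 - (u ^ N) ^ 2) - (S.p + c * S.r * u ^ N)) *
        ((1 - (u ^ N) ^ 2) + (S.p + c * S.r * u ^ N))) := by
  have hquad := congrArg I S.Ts_mul_Ts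
  simp only [map_mul, map_add, AlgHom.commutes, hT] at hquad
  obtain ⟨h1, h2⟩ := S'.quadratic_coefficients hquad
  obtain ⟨-, h3⟩ := bernstein_of_hom S S' I hT hP hc hy hI
  have h4 := quadratic_elimination
    (by rw [p, map_sub, map_one]) (by rw [p, map_sub, map_one]) h1 h2 h3
  have h5 := congrArg (S'.eval (Units.mk0 u hu)) h4
  have hx : S'.eval (Units.mk0 u hu) (single (-S'.coroot) 1) = u ^ 2 := by
    rw [eval_single, map_neg, S'.root_coroot, neg_neg, one_mul]
    exact zpow_ofNat u 2
  have hz : S'.eval (Units.mk0 u hu) (single (-y) 1) = u ^ N := by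
    rw [eval_single, map_neg, S'.root_eq_of_two_smul_eq hy, neg_neg, one_mul]
    rfl
  have hPP : S'.eval (Units.mk0 u hu) P * S'.eval (Units.mk0 u hu) (S'.reflection P) = c' ^ 2 := by
    rw [hPk, S'.reflection_single_of_two_smul_eq hyk, ← map_mul,
      AddMonoidAlgebra.single_mul_single, add_neg_cancel, eval_single, map_zero, neg_zero, zpow_zero,
      mul_one, sq]
  simp only [map_mul, map_add, map_sub, map_pow, map_one, num, den, hx, hz, hPP,
    AlgHom.commutes, Algebra.algebraMap_self, RingHom.id_apply] at h5
  exact h5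

theorem classification_of_hom (hT : I S.Ts = S'.emb P * S'.Ts + S'.emb b) (hP : P ≠ 0)
    {c c' : ℂ} (hc : c ≠ 0) (hc' : c' ≠ 0) {K : ℤ} {yk : Y'}
    (hyk : (2 : ℤ) • yk = K • S'.coroot) (hPk : P = single yk c') {N : ℤ} (hN : 0 < N) {y : Y'}
    (hy : (2 : ℤ) • y = N • S'.coroot) (hI : I (S.θ S.coroot) = c • S'.θ y) :
    c = 1 ∧ y = S'.coroot ∧ ((√S.q1 = √S'.q1 ∧ √S.q0 = √S'.q0) ∨
      (√S.q1 = √S'.q0 ∧ √S.q0 = √S'.q1)) := by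
  obtain ⟨a, d, ha, hd, haq, -, has, hds, hp, hr⟩ := S.parameters
  obtain ⟨a', d', ha', hd', haq', -, has', hds', hp', hr'⟩ := S'.parameters
  obtain ⟨hc2, -⟩ := bernstein_of_hom S S' I hT hP hc hy hI
  lift N to ℕ using hN.le
  have hd0 : (d : ℂ) ≠ 0 := by exact_mod_cast (by linarith : d ≠ 0)
  have hd0' : (d' : ℂ) ≠ 0 := by exact_mod_cast (by linarith : d' ≠ 0)
  have key (u : ℂ) (hu : u ≠ 0) :
      c' ^ 2 * d ^ 2 / d' ^ 2 * reducibilityPoly a' d' (u ^ 2) * (1 - (c * u ^ N) ^ 2) ^ 2 =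
        (1 - (u ^ 2) ^ 2) ^ 2 * reducibilityPoly a d (c * u ^ N) := by
    have h := polynomial_identity_of_hom S S' I hT hP hc hyk hPk hy hI u hu
    rw [hp, hr, hp', hr', haq, haq'] at h
    rw [reducibilityPoly_eq hd, reducibilityPoly_eq hd', mul_pow c, hc2, one_mul]
    rw [zpow_natCast] at h
    have e : c' ^ 2 * (d : ℂ) ^ 2 / d' ^ 2 * d' ^ 2 = c' ^ 2 * d ^ 2 :=
      div_mul_cancel₀ _ (pow_ne_zero 2 hd0')
    push_cast at h
    rw [← mul_assoc _ ((d' : ℂ) ^ 2), e]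
    linear_combination (d : ℂ) ^ 2 * h
  obtain ⟨h1, h2, h3⟩ := reducibilityPoly_comparison ha hd ha' hd'
    (div_ne_zero (mul_ne_zero (pow_ne_zero 2 hc') (pow_ne_zero 2 hd0)) (pow_ne_zero 2 hd0')) hc2
    (by omega) key
  have := S'.isAddTorsionFree
  subst h2
  refine ⟨h1, zsmul_right_injective two_ne_zero hy, ?_⟩
  rwa [has, hds, has', hds']

theorem remainder_of_hom (hT : I S.Ts = S'.emb P * S'.Ts + S'.emb b) (hP : P ≠ 0)
    (hI : I (S.θ S.coroot) = S'.θ S'.coroot) :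
    b * S'.den = algebraMap ℂ _ S.p + algebraMap ℂ _ S.r * single (-S'.coroot) 1 - P * S'.num := by
  have := S'.isDomain
  obtain ⟨-, h⟩ := bernstein_of_hom S S' I hT hP one_ne_zero (N := 2) rfl (by rw [hI, one_smul])
  rw [one_mul, mul_comm, ← den] at h
  have := mul_right_cancel₀ S'.den_ne_zero h
  rw [← this]
  ring

theorem parameters_of_remainder {c' : ℂ} {K : ℤ} {yk : Y'}
    (hyk : (2 : ℤ) • yk = K • S'.coroot) (hPk : P = single yk c')
    (hb : b * S'.den =
      algebraMap ℂ _ S.p + algebraMap ℂ _ S.r * single (-S'.coroot) 1 - P * S'.num) :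
    ∃ k : ℤ, K = 2 * k ∧ S.p + S.r = c' * (S'.p + S'.r) ∧
      S.p - S.r = c' * (-1) ^ k * (S'.p - S'.r) := by
  have ev (u : ℂˣ) (hu : (1 : ℂ) - ((u : ℂ) ^ 2) ^ 2 = 0) :
      S.p + S.r * (u : ℂ) ^ 2 = c' * (u : ℂ) ^ (-K) * (S'.p + S'.r * (u : ℂ) ^ 2) := by
    have h := congrArg (S'.eval u) hb
    have hx : S'.eval u (single (-S'.coroot) 1) = (u : ℂ) ^ 2 := by
      rw [eval_single, map_neg, S'.root_coroot, neg_neg, one_mul]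
      exact zpow_ofNat _ 2
    have hPe : S'.eval u P = c' * (u : ℂ) ^ (-K) := by
      rw [hPk, eval_single, S'.root_eq_of_two_smul_eq hyk]
    simp only [map_mul, map_add, map_sub, map_pow, map_one, num, den, hx, hPe,
      AlgHom.commutes, Algebra.algebraMap_self, RingHom.id_apply, hu, mul_zero] at h
    exact (sub_eq_zero.1 h.symm)
  have e1 := ev 1 (by simp)
  have e2 := ev (-1) (by simp)
  have e3 := ev (Units.mk0 Complex.I Complex.I_ne_zero) (by simp)
  simp only [Units.val_one, Units.val_neg, neg_sq, one_pow, one_zpow, mul_one] at e1 e2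
  rcases Int.even_or_odd' K with ⟨k, rfl | rfl⟩
  · refine ⟨k, rfl, e1, ?_⟩
    rw [Units.val_mk0, Complex.I_sq, ← mul_neg, zpow_mul] at e3
    have : Complex.I ^ (2 : ℤ) = -1 := by rw [← Complex.I_sq]; exact zpow_ofNat _ 2
    rw [this, zpow_neg, ← inv_zpow, inv_neg_one] at e3
    linear_combination e3
  · exfalso
    have hodd : (-1 : ℂ) ^ (-(2 * k + 1)) = -1 := (odd_two_mul_add_one k).neg.neg_one_zpow
    rw [hodd] at e2
    apply S.p_add_r_ne_zero
    have : S.p + S.r = -(S.p + S.r) := by linear_combination e2 + e1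
    exact self_eq_neg.1 this

theorem scalar_and_parameters_of_proportional {c' : ℂ}
    (h : (√S.q1 = √S'.q1 ∧ √S.q0 = √S'.q0) ∨ (√S.q1 = √S'.q0 ∧ √S.q0 = √S'.q1))
    (hp : S.p = c' * S'.p) (hr : S.r = c' * S'.r) :
    c' = 1 ∧ S.q1 = S'.q1 ∧ S.q0 = S'.q0 := by
  obtain ⟨a, d, ha, hd, haq, hdq, has, hds, hpa, hra⟩ := S.parameters
  obtain ⟨a', d', ha', hd', haq', hdq', has', hds', hpa', hra'⟩ := S'.parameters
  have hsum : S.p + S.r = c' * (S'.p + S'.r) := by rw [hp, hr, mul_add]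
  rw [has, hds, has', hds'] at h
  rw [hpa, hra, hpa', hra'] at hsum
  rw [hpa, hpa'] at hp
  rw [haq, hdq, haq', hdq']
  rcases h with ⟨rfl, rfl⟩ | ⟨rfl, rfl⟩
  · exact ⟨scalar_of_parameters_eq ha hd hsum, rfl, rfl⟩
  · have hc := scalar_of_parameters_swap ha' hd' hsum
    rw [hc] at hp
    obtain rfl := eq_of_swap_of_proportional ha' hd' hp
    exact ⟨scalar_of_parameters_eq ha hd hsum, rfl, rfl⟩

theorem scalar_and_parameters_of_swapped_proportional {c' : ℂ}
    (h : (√S.q1 = √S'.q1 ∧ √S.q0 = √S'.q0) ∨ (√S.q1 = √S'.q0 ∧ √S.q0 = √S'.q1))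
    (hp : S.p = c' * S'.r) (hr : S.r = c' * S'.p) :
    ((√(S'.q0 / S'.q1) : ℝ) : ℂ) = c' ∧ S.q1 = S'.q0 ∧ S.q0 = S'.q1 := by
  obtain ⟨a, d, ha, hd, haq, hdq, has, hds, hpa, hra⟩ := S.parameters
  obtain ⟨a', d', ha', hd', haq', hdq', has', hds', hpa', hra'⟩ := S'.parameters
  have hsum : S.p + S.r = c' * (S'.p + S'.r) := by rw [hp, hr, mul_add, add_comm]
  rw [Real.sqrt_div' _ (by linarith [S'.one_lt_q1])]
  rw [has, hds, has', hds'] at h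
  rw [hpa, hra, hpa', hra'] at hsum
  rw [hpa, hra'] at hp
  rw [has', hds', haq, hdq, haq', hdq', Complex.ofReal_div]
  rcases h with ⟨rfl, rfl⟩ | ⟨rfl, rfl⟩
  · have hc := scalar_of_parameters_eq ha hd hsum
    rw [hc, one_mul] at hp
    obtain rfl := eq_of_self_proportional ha hd hp
    exact ⟨(scalar_of_parameters_swap ha' hd' hsum).symm, rfl, rfl⟩
  · exact ⟨(scalar_of_parameters_swap ha' hd' hsum).symm, rfl, rfl⟩

end Hom

end RankOneAffineHecke

/-- Let `I : H → H'` be a homomorphism of unital `ℂ`-algebras between two rank-one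
affine Hecke algebras.  Assume `I(T_s) = c′·θ_{k·α′∨}·T_{s′} + b′` where `k` is a
rational number with `2k ∈ ℤ` and `k·α′∨ ∈ Y′` (encoded by `yk ∈ Y′` with
`2·yk = K·α′∨` for `K = 2k ∈ ℤ`), `c′ ≠ 0` and `b′ ∈ ℂ[Y′]`, and assume
`I(θ_{α∨}) = c·θ_{n·α′∨}` with `c ≠ 0` and `n > 0` a rational with `2n ∈ ℤ` and
`n·α′∨ ∈ Y′` (encoded likewise).  Then `k ∈ ℤ`, `n = 1`, `c = 1`, and the even/odd
dichotomy on `k` determines `I(T_s)` and the parameters as stated. -/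
theorem rankOneAffineHecke_hom_classification
    {Y : Type*} [AddCommGroup Y] {H : Type*} [Ring H] [Algebra ℂ H]
    {Y' : Type*} [AddCommGroup Y'] {H' : Type*} [Ring H'] [Algebra ℂ H']
    (S : RankOneAffineHecke Y H) (S' : RankOneAffineHecke Y' H')
    (I : H →ₐ[ℂ] H')
    (c' : ℂ) (hc' : c' ≠ 0) (K : ℤ) (yk : Y')
    (hyk : (2 : ℤ) • yk = K • S'.coroot)
    (b' : AddMonoidAlgebra ℂ Y')
    (hITs : I S.Ts = c' • (S'.θ yk * S'.Ts) + S'.emb b')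
    (c : ℂ) (hc : c ≠ 0) (N : ℤ) (hN : 0 < N) (yn : Y')
    (hyn : (2 : ℤ) • yn = N • S'.coroot)
    (hIθ : I (S.θ S.coroot) = c • S'.θ yn) :
    c = 1 ∧ yn = S'.coroot ∧ I (S.θ S.coroot) = S'.θ S'.coroot ∧
    ∃ k : ℤ, yk = k • S'.coroot ∧
      (Even k →
        c' = 1 ∧
        ∃ m : ℤ, k = 2 * m ∧
          I S.Ts = S'.θ (m • S'.coroot) * S'.Ts * S'.θ (-(m • S'.coroot)) ∧
          S.q1 = S'.q1 ∧ S.q0 = S'.q0) ∧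
      (Odd k →
        ∃ m : ℤ, k = 2 * m + 1 ∧
          I S.Ts = S'.θ (m • S'.coroot) *
            (((Real.sqrt (S'.q0 / S'.q1) : ℝ) : ℂ) •
              (S'.θ S'.coroot * S'.Ts - ((S'.q1 : ℂ) - 1) • S'.θ S'.coroot)) *
            S'.θ (-(m • S'.coroot)) ∧
          S.q1 = S'.q0 ∧ S.q0 = S'.q1) := by
  have := S'.isAddTorsionFree
  have hP : (AddMonoidAlgebra.single yk c' : AddMonoidAlgebra ℂ Y') ≠ 0 := by
    simpa using hc'
  have hPa : (AddMonoidAlgebra.single yk c' : AddMonoidAlgebra ℂ Y') =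
      algebraMap ℂ _ c' * AddMonoidAlgebra.single yk 1 := by
    rw [← Algebra.smul_def, AddMonoidAlgebra.smul_single, smul_eq_mul, mul_one]
  have hT : I S.Ts = S'.emb (AddMonoidAlgebra.single yk c') * S'.Ts + S'.emb b' := by
    rw [hITs, hPa, map_mul, AlgHom.commutes, ← Algebra.smul_def, smul_mul_assoc,
      RankOneAffineHecke.θ]
  obtain ⟨rfl, rfl, hparam⟩ :=
    RankOneAffineHecke.classification_of_hom S S' I hT hP hc hc' hyk rfl hN hyn hIθ
  rw [one_smul] at hIθ
  have hb := RankOneAffineHecke.remainder_of_hom S S' I hT hP hIθ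
  obtain ⟨k, rfl, hplus, hminus⟩ := RankOneAffineHecke.parameters_of_remainder S S' hyk rfl hb
  obtain rfl : yk = k • S'.coroot :=
    zsmul_right_injective (two_ne_zero (α := ℤ)) (by simpa only [mul_smul] using hyk)
  refine ⟨rfl, rfl, hIθ, k, rfl, ?_, ?_⟩
  · intro hk
    obtain ⟨m, rfl⟩ := hk.two_dvd
    rw [hk.neg_one_zpow, mul_one] at hminus
    have hpp : S.p = c' * S'.p := by linear_combination (hplus + hminus) / 2
    have hrr : S.r = c' * S'.r := by linear_combination (hplus - hminus) / 2
    obtain ⟨hc1, h1, h0⟩ := RankOneAffineHecke.scalar_and_parameters_of_proportional S S' hparam hpp hrr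
    subst hc1
    refine ⟨rfl, m, rfl, ?_, h1, h0⟩
    rw [hT]
    apply S'.conj_Ts
    rw [hb, hpp, hrr, one_mul, one_mul, ← RankOneAffineHecke.num]
  · intro hk
    obtain ⟨m, rfl⟩ := hk
    rw [(odd_two_mul_add_one m).neg_one_zpow] at hminus
    have hpr : S.p = c' * S'.r := by linear_combination (hplus + hminus) / 2
    have hrp : S.r = c' * S'.p := by linear_combination (hplus - hminus) / 2
    obtain ⟨hc1, h1, h0⟩ := RankOneAffineHecke.scalar_and_parameters_of_swapped_proportional S S' hparam hpr hrp
    refine ⟨m, rfl, ?_, h1, h0⟩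
    rw [hT, hPa, hc1]
    apply S'.conj_Ts_zero
    rw [hb, hpr, hrp, hPa, map_mul, map_mul]
    ring

end
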